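/- For every positive integer t, there exist connected finite simple graphs G and H such that G is a subgraph of H, gon(H) = 2 and gon(G) ≥ t. -/

import Mathlib

open SimpleGraph Finset
open scoped Classical

noncomputable section

def lap {V : Type} [Fintype V] (G : SimpleGraph V) (S : V → ℤ) : V → ℤ :=
  fun v => ∑ w : V, if G.Adj v w then S v - S w else 0

def Effective {V : Type} (D : V → ℤ) : Prop := ∀ v, 0 ≤ D v

def degDiv {V : Type} [Fintype V] (D : V → ℤ) : ℤ := ∑ v, D v

def LinEquiv {V : Type} [Fintype V] (G : SimpleGraph V) (D D' : V → ℤ) : Prop :=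
  ∃ S : V → ℤ, D' = D - lap G S

def PosRank {V : Type} [Fintype V] (G : SimpleGraph V) (D : V → ℤ) : Prop :=
  ∀ v : V, ∃ D' : V → ℤ, Effective D' ∧ LinEquiv G D D' ∧ 1 ≤ D' v

def gonality {V : Type} [Fintype V] (G : SimpleGraph V) : ℕ :=
  sInf {n : ℕ | ∃ D : V → ℤ, Effective D ∧ PosRank G D ∧ degDiv D = (n : ℤ)}

def indic {V : Type} (A : Set V) : V → ℤ := fun v => if v ∈ A then 1 else 0

lemma lap_add {V : Type} [Fintype V] (G : SimpleGraph V) (S T : V → ℤ) :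
    lap G (S + T) = lap G S + lap G T := by
  ext v
  simp only [lap, Pi.add_apply, ← Finset.sum_add_distrib]
  refine Finset.sum_congr rfl fun w _ => ?_
  split_ifs <;> ring

lemma lap_neg {V : Type} [Fintype V] (G : SimpleGraph V) (S : V → ℤ) :
    lap G (-S) = -lap G S := by
  ext v
  simp only [lap, Pi.neg_apply, ← Finset.sum_neg_distrib]
  refine Finset.sum_congr rfl fun w _ => ?_
  split_ifs <;> ring

lemma LinEquiv.refl {V : Type} [Fintype V] (G : SimpleGraph V) (D : V → ℤ) :
    LinEquiv G D D :=
  ⟨0, by ext v; simp [lap]⟩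

lemma LinEquiv.symm {V : Type} [Fintype V] {G : SimpleGraph V} {D D' : V → ℤ}
    (h : LinEquiv G D D') : LinEquiv G D' D := by
  obtain ⟨S, rfl⟩ := h
  exact ⟨-S, by rw [lap_neg]; abel⟩

lemma LinEquiv.trans {V : Type} [Fintype V] {G : SimpleGraph V} {D D' D'' : V → ℤ}
    (h : LinEquiv G D D') (h' : LinEquiv G D' D'') : LinEquiv G D D'' := by
  obtain ⟨S, rfl⟩ := h
  obtain ⟨T, rfl⟩ := h'
  exact ⟨S + T, by rw [lap_add]; abel⟩

/-- The Laplacian is self-adjoint. -/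
lemma sum_mul_lap {V : Type} [Fintype V] (G : SimpleGraph V) (F S : V → ℤ) :
    ∑ v, F v * lap G S v = ∑ v, S v * lap G F v := by
  have key : ∀ A B : V → ℤ, ∑ v, A v * lap G B v =
      (∑ v, ∑ w, if G.Adj v w then A v * B v else 0) -
        ∑ v, ∑ w, if G.Adj v w then A v * B w else 0 := by
    intro A B
    simp only [lap, Finset.mul_sum, ← Finset.sum_sub_distrib]
    refine Finset.sum_congr rfl fun v _ => Finset.sum_congr rfl fun w _ => ?_
    split_ifs <;> ring
  rw [key, key]
  congr 1
  · simp only [mul_comm]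
  · rw [Finset.sum_comm]
    simp only [mul_comm, G.adj_comm]

lemma LinEquiv.dvd_sum_mul_sub {V : Type} [Fintype V] {G : SimpleGraph V} {D D' : V → ℤ}
    (h : LinEquiv G D D') {m : ℤ} {F : V → ℤ} (hF : ∀ v, m ∣ lap G F v) :
    m ∣ ∑ v, F v * (D v - D' v) := by
  obtain ⟨S, rfl⟩ := h
  simp only [Pi.sub_apply, sub_sub_cancel]
  rw [sum_mul_lap]
  exact Finset.dvd_sum fun v _ => (hF v).mul_left _

lemma LinEquiv.degDiv_eq {V : Type} [Fintype V] {G : SimpleGraph V} {D D' : V → ℤ}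
    (h : LinEquiv G D D') : degDiv D = degDiv D' := by
  have h1 := h.dvd_sum_mul_sub (m := 0) (F := fun _ => 1) (by simp [lap])
  simp only [one_mul, Finset.sum_sub_distrib, zero_dvd_iff] at h1
  exact sub_eq_zero.mp h1

/-- A divisor of positive rank exists, so lower bounds for `gonality` can be checked on
divisors. -/
lemma le_gonality {V : Type} [Fintype V] {G : SimpleGraph V} {t : ℕ}
    (h : ∀ D : V → ℤ, Effective D → PosRank G D → (t : ℤ) ≤ degDiv D) : t ≤ gonality G := by
  refine le_csInf ⟨Fintype.card V, fun _ => 1, fun _ => zero_le_one,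
    fun v => ⟨fun _ => 1, fun _ => zero_le_one, LinEquiv.refl _ _, le_rfl⟩, by simp [degDiv]⟩ ?_
  rintro n ⟨D, hD, hr, hn⟩
  have := h D hD hr
  omega

lemma lap_comp_iso {V W : Type} [Fintype V] [Fintype W] {G : SimpleGraph V}
    {G' : SimpleGraph W} (e : G ≃g G') (S : W → ℤ) : lap G (S ∘ e) = lap G' S ∘ e := by
  ext v
  simp only [lap, Function.comp_apply]
  rw [← e.toEquiv.sum_comp]
  exact Finset.sum_congr rfl fun w _ => if_congr e.map_adj_iff.symm rfl rfl

lemma le_gonality_of_iso {V W : Type} [Fintype V] [Fintype W] {G : SimpleGraph V}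
    {G' : SimpleGraph W} (e : G ≃g G') {t : ℕ}
    (h : ∀ D : V → ℤ, Effective D → PosRank G D → (t : ℤ) ≤ degDiv D) : t ≤ gonality G' := by
  refine le_gonality fun D hD hr => ?_
  have h1 : degDiv (D ∘ e) = degDiv D := e.toEquiv.sum_comp D
  rw [← h1]
  refine h _ (fun v => hD _) fun v => ?_
  obtain ⟨D', hD', ⟨S, rfl⟩, hv⟩ := hr (e v)
  exact ⟨(D - lap G' S) ∘ e, fun v => hD' _, ⟨S ∘ e, by rw [lap_comp_iso]; rfl⟩, hv⟩

lemma sum_ite_val_eq {n a : ℕ} (ha : a < n) (z : ℤ) :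
    (∑ w : Fin n, if (w : ℕ) = a then z else 0) = z := by
  rw [Finset.sum_eq_single (⟨a, ha⟩ : Fin n)]
  · simp
  · intro b _ hb
    exact if_neg fun h => hb (Fin.ext h)
  · simp

/-- The ladder whose `x`-th rung joins `2 * x` and `2 * x + 1`. -/
def ladder (n : ℕ) : SimpleGraph (Fin n) where
  Adj v w := (v : ℕ) + 2 = w ∨ (w : ℕ) + 2 = v ∨ ((v : ℕ) ≠ w ∧ (v : ℕ) / 2 = w / 2)
  symm := ⟨fun v w h => by omega⟩
  loopless := ⟨fun v h => by omega⟩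

/-- The divisor with one chip at each end of the `x`-th rung of the ladder. -/
def rung (n x : ℕ) : Fin n → ℤ := fun v => if (v : ℕ) / 2 = x then 1 else 0

lemma rung_linEquiv_succ {n x : ℕ} (hn : 2 * x + 4 ≤ n) :
    LinEquiv (ladder n) (rung n x) (rung n (x + 1)) := by
  refine ⟨fun v => if (v : ℕ) < 2 * x + 2 then 1 else 0, ?_⟩
  ext v
  simp only [Pi.sub_apply, lap]
  by_cases hv : (v : ℕ) < 2 * x + 2
  · by_cases hv' : 2 * x ≤ (v : ℕ)
    · rw [Finset.sum_congr rfl (g := fun w : Fin n => if (w : ℕ) = v + 2 then (1 : ℤ) else 0),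
        sum_ite_val_eq (by omega)]
      · unfold rung
        split_ifs <;> omega
      · intro w _
        simp only [ladder]
        split_ifs <;> omega
    · rw [Finset.sum_eq_zero]
      · unfold rung
        split_ifs <;> omega
      · intro w _
        simp only [ladder]
        split_ifs <;> omega
  · by_cases hv' : (v : ℕ) < 2 * x + 4
    · rw [Finset.sum_congr rfl (g := fun w : Fin n => if (w : ℕ) = v - 2 then (-1 : ℤ) else 0),
        sum_ite_val_eq (by omega)]
      · unfold rung
        split_ifs <;> omega
      · intro w _
        simp only [ladder]
        split_ifs <;> omega
    · rw [Finset.sum_eq_zero]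
      · unfold rung
        split_ifs <;> omega
      · intro w _
        simp only [ladder]
        split_ifs <;> omega

lemma rung_linEquiv {n x : ℕ} (hn : 2 * x + 2 ≤ n) :
    LinEquiv (ladder n) (rung n 0) (rung n x) := by
  induction x with
  | zero => exact LinEquiv.refl _ _
  | succ x ih => exact (ih (by omega)).trans (rung_linEquiv_succ (by omega))

lemma effective_rung (n x : ℕ) : Effective (rung n x) := fun v => by
  unfold rung; split_ifs <;> simp

lemma degDiv_rung_zero {n : ℕ} (hn : 2 ≤ n) : degDiv (rung n 0) = 2 := by
  unfold degDiv
  rw [Finset.sum_congr rfl (g := fun w : Fin n =>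
      (if (w : ℕ) = 0 then (1 : ℤ) else 0) + if (w : ℕ) = 1 then (1 : ℤ) else 0),
    Finset.sum_add_distrib, sum_ite_val_eq (by omega), sum_ite_val_eq (by omega)]
  · norm_num
  · intro w _
    unfold rung
    split_ifs <;> omega

lemma posRank_rung_zero {n : ℕ} (hn : Even n) : PosRank (ladder n) (rung n 0) := fun v =>
  ⟨rung n (v / 2), effective_rung _ _,
    rung_linEquiv (by obtain ⟨m, rfl⟩ := hn; have := v.isLt; omega), by simp [rung]⟩

lemma Effective.eq_single {V : Type} [Fintype V] {D : V → ℤ} (hD : Effective D)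
    (hdeg : degDiv D ≤ 1) {v : V} (hv : 1 ≤ D v) : D = Pi.single v 1 := by
  have h : D v + ∑ u ∈ univ.erase v, D u = degDiv D :=
    Finset.add_sum_erase _ _ (Finset.mem_univ v)
  have h0 : 0 ≤ ∑ u ∈ univ.erase v, D u := Finset.sum_nonneg fun u _ => hD u
  have h1 : ∑ u ∈ univ.erase v, D u = 0 := by omega
  rw [Finset.sum_eq_zero_iff_of_nonneg fun u _ => hD u] at h1
  ext u
  by_cases hu : u = v
  · subst hu
    simp only [Pi.single_eq_same]
    omega
  · rw [Pi.single_eq_of_ne hu]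
    exact h1 u (by simp [hu])

lemma eq_of_lap_nonpos {V : Type} [Fintype V] {G : SimpleGraph V} {S : V → ℤ} {v w : V}
    (hmax : ∀ u, S u ≤ S v) (hv : lap G S v ≤ 0) (h : G.Adj v w) : S w = S v := by
  have h0 : ∀ u ∈ univ, 0 ≤ if G.Adj v u then S v - S u else 0 := fun u _ => by
    have := hmax u
    split_ifs <;> omega
  have h1 := (Finset.sum_eq_zero_iff_of_nonneg h0).1
    (le_antisymm hv (Finset.sum_nonneg h0)) w (Finset.mem_univ w)
  rw [if_pos h] at h1
  omega

lemma not_linEquiv_single_ladder {n : ℕ} (hn : 4 ≤ n) :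
    ¬ LinEquiv (ladder n) (Pi.single ⟨0, by omega⟩ 1) (Pi.single ⟨1, by omega⟩ 1) := by
  rintro ⟨S, hS⟩
  have hlap : ∀ v, lap (ladder n) S v =
      (if (v : ℕ) = 0 then 1 else 0) - if (v : ℕ) = 1 then 1 else 0 := by
    intro v
    have h := congrFun hS v
    simp only [Pi.sub_apply, Pi.single_apply, Fin.ext_iff] at h
    linarith
  have : Nonempty (Fin n) := ⟨⟨0, by omega⟩⟩
  obtain ⟨m, hm⟩ := Finite.exists_max S
  have hprop : ∀ v w : Fin n, (v : ℕ) ≠ 0 → S v = S m → (ladder n).Adj v w → S w = S m := by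
    intro v w hv hvm hadj
    rw [← hvm]
    refine eq_of_lap_nonpos (by rwa [hvm]) ?_ hadj
    rw [hlap]
    split_ifs <;> simp_all
  have hone : ∀ h1 : 1 < n, S ⟨1, h1⟩ ≠ S m := by
    intro h1 h
    have h2 : 0 ≤ lap (ladder n) S ⟨1, h1⟩ := Finset.sum_nonneg fun u _ => by
      have := hm u
      split_ifs <;> omega
    rw [hlap] at h2
    norm_num at h2
  have hpos : ∀ (v : ℕ) (hv : v < n), 1 ≤ v → S ⟨v, hv⟩ ≠ S m := by
    intro v
    induction v using Nat.strong_induction_on with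
    | _ v ih =>
      intro hv h1 h
      by_cases hv1 : v = 1
      · subst hv1
        exact hone hv h
      by_cases hv2 : v = 2
      · subst hv2
        have h3 := hprop _ ⟨3, by omega⟩ (by simp) h (by simp [ladder])
        exact hone (by omega) (hprop _ ⟨1, by omega⟩ (by simp) h3 (by simp [ladder]))
      · refine ih (v - 2) (by omega) (by omega) (by omega)
          (hprop _ _ (by simp; omega) h ?_)
        simp only [ladder]
        omega
  have hm0 : (m : ℕ) = 0 := by
    by_contra h
    exact hpos m m.isLt (by omega) rfl
  have h1 := hpos 1 (by omega) le_rfl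
  have h2 := hpos 2 (by omega) (by norm_num)
  have hle : ∑ w : Fin n, ((if (w : ℕ) = 1 then (1 : ℤ) else 0) + if (w : ℕ) = 2 then 1 else 0)
      ≤ lap (ladder n) S m := by
    refine Finset.sum_le_sum fun w _ => ?_
    have hw := hm w
    by_cases hw1 : (w : ℕ) = 1
    · have : S w ≠ S m := by convert h1
      rw [if_pos hw1, if_neg (by omega), if_pos (by simp only [ladder]; omega)]
      omega
    · by_cases hw2 : (w : ℕ) = 2
      · have : S w ≠ S m := by convert h2
        rw [if_neg hw1, if_pos hw2, if_pos (by simp only [ladder]; omega)]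
        omega
      · rw [if_neg hw1, if_neg hw2]
        split_ifs <;> omega
  rw [Finset.sum_add_distrib, sum_ite_val_eq (by omega), sum_ite_val_eq (by omega), hlap] at hle
  simp [hm0] at hle

theorem gonality_ladder {n : ℕ} (hn : 4 ≤ n) (he : Even n) : gonality (ladder n) = 2 := by
  apply le_antisymm
  · exact Nat.sInf_le ⟨rung n 0, effective_rung _ _, posRank_rung_zero he,
      degDiv_rung_zero (by omega)⟩
  · refine le_gonality fun D hD hr => ?_
    by_contra hlt
    obtain ⟨D₀, hD₀, he₀, h₀⟩ := hr ⟨0, by omega⟩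
    obtain ⟨D₁, hD₁, he₁, h₁⟩ := hr ⟨1, by omega⟩
    have hd₀ := he₀.degDiv_eq
    have hd₁ := he₁.degDiv_eq
    have h := he₀.symm.trans he₁
    rw [hD₀.eq_single (by push_cast at hlt; omega) h₀,
      hD₁.eq_single (by push_cast at hlt; omega) h₁] at h
    refine not_linEquiv_single_ladder hn ?_
    convert h

/-- The relation joining `v` to the larger vertex `w` in the chain of cycles. -/
def ChainStep (c v w : ℕ) : Prop :=
  (v % 2 = 0 ∧ v + 1 = w ∧ (v % c = 0 ∨ v % c + 2 = c)) ∨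
    (v + 2 = w ∧ (v % 2 = 0 ∨ v % c + 1 ≠ c))

/-- A subgraph of the ladder: a chain of cycles of length `c` (for even `c`) on consecutive blocks
of `c` vertices, with the last even vertex of each block joined to the first vertex of the next
one. -/
def cycleChain (c n : ℕ) : SimpleGraph (Fin n) where
  Adj v w := ChainStep c v w ∨ ChainStep c w v
  symm := ⟨fun _ _ h => h.symm⟩
  loopless := ⟨fun v h => by unfold ChainStep at h; omega⟩

lemma cycleChain_le_ladder (c n : ℕ) : cycleChain c n ≤ ladder n := fun v w h => by
  simp only [cycleChain, ChainStep, ladder] at h ⊢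
  omega

lemma cycleChain_connected {c n : ℕ} (hn : 0 < n) :
    (cycleChain c n).Connected := by
  have key : ∀ (v : ℕ) (hv : v < n), (cycleChain c n).Reachable ⟨v, hv⟩ ⟨0, hn⟩ := by
    intro v
    induction v using Nat.strong_induction_on with
    | _ v ih =>
      intro hv
      obtain rfl | h0 := Nat.eq_zero_or_pos v
      · exact Reachable.refl _
      by_cases h1 : v % 2 = 1 ∧ (v - 1) % c = 0
      · refine (Adj.reachable ?_).trans (ih (v - 1) (by omega) (by omega))
        simp only [cycleChain, ChainStep]
        omega
      · have h2 : 2 ≤ v := by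
          by_contra h
          obtain rfl : v = 1 := by omega
          simp at h1
        refine (Adj.reachable ?_).trans (ih (v - 2) (by omega) (by omega))
        simp only [cycleChain, ChainStep]
        by_cases he : v % 2 = 0
        · omega
        · have h3 : (v - 2) % c + 1 ≠ c := by
            intro h
            apply h1
            refine ⟨by omega, ?_⟩
            have h4 := Nat.div_add_mod (v - 2) c
            exact Nat.mod_eq_zero_of_dvd ⟨(v - 2) / c + 1, by rw [mul_add]; omega⟩
          omega
  have : Nonempty (Fin n) := ⟨⟨0, hn⟩⟩
  exact ⟨fun v w => (key v v.isLt).trans (key w w.isLt).symm⟩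

/-- A function which is harmonic modulo `4 * t` on the chain of cycles of length `4 * t`, winds
once around the cycle starting at `a`, and is constant on either side of it. -/
def winding (t a v : ℕ) : ℤ :=
  if v < a then 0 else if a + 4 * t ≤ v then 2 * t - 1
    else if v % 2 = 0 then ((v - a) / 2 : ℕ) else -((v - a + 1) / 2 : ℕ)

/-- The successor of `v` on the cycle with vertices `a, ..., a + c - 1`. -/
def cycleSucc (c a v : ℕ) : ℕ :=
  if v % 2 = 0 then (if v + 2 = a + c then v + 1 else v + 2)
    else if v = a + 1 then v - 1 else v - 2

/-- The predecessor of `v` on the cycle with vertices `a, ..., a + c - 1`. -/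
def cyclePred (c a v : ℕ) : ℕ :=
  if v % 2 = 0 then (if v = a then v + 1 else v - 2)
    else if v + 1 = a + c then v - 1 else v + 2

lemma mod_of_mem_block {c j v : ℕ} (h : c * j ≤ v) (h' : v < c * j + c) :
    v % c = v - c * j := by
  obtain ⟨p, rfl⟩ := Nat.exists_eq_add_of_le h
  rw [Nat.mul_add_mod, Nat.mod_eq_of_lt (by omega)]
  omega

lemma mod_add_one_of_add_one_eq {c j v : ℕ} (h : v + 1 = c * j) : v % c + 1 = c := by
  obtain ⟨i, rfl⟩ : ∃ i, j = i + 1 := Nat.exists_eq_succ_of_ne_zero (by rintro rfl; simp at h)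
  have hc : 0 < c := Nat.pos_of_ne_zero (by rintro rfl; simp at h)
  rw [mul_add, mul_one] at h
  rw [mod_of_mem_block (j := i) (by omega) (by omega)]
  omega

set_option maxHeartbeats 1000000 in
lemma chainStep_cases {t j v w : ℕ} (ht : 1 ≤ t) (hv : 4 * t * j ≤ v)
    (hv' : v < 4 * t * j + 4 * t) :
    ChainStep (4 * t) v w ∨ ChainStep (4 * t) w v ↔
      w = cyclePred (4 * t) (4 * t * j) v ∨ w = cycleSucc (4 * t) (4 * t * j) v ∨
        (v + 2 = 4 * t * j + 4 * t ∧ w = v + 2) ∨ (v = 4 * t * j ∧ v = w + 2) := by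
  have hmv := mod_of_mem_block hv hv'
  have hmw := mod_of_mem_block (c := 4 * t) (j := j) (v := w)
  have hmw' := mod_add_one_of_add_one_eq (c := 4 * t) (j := j) (v := w)
  have ha : (4 * t * j) % 2 = 0 := by
    rw [mul_assoc, Nat.mul_mod]
    simp
  unfold ChainStep cyclePred cycleSucc
  generalize 4 * t * j = a at *
  generalize v % (4 * t) = mv at *
  generalize w % (4 * t) = mw at *
  subst hmv
  by_cases hw : a ≤ w ∧ w < a + 4 * t
  · rw [hmw hw.1 hw.2]
    clear hmw hmw'
    constructor
    · rintro ((h | h) | (h | h)) <;> split_ifs <;> omega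
    · rintro (h | h | h | h) <;> (try split_ifs at h) <;> omega
  · clear hmw
    constructor
    · rintro ((h | h) | (h | h)) <;> split_ifs <;> omega
    · rintro (h | h | h | h) <;> (try split_ifs at h) <;> omega

lemma winding_sub_cyclePred {t a v : ℕ} (ht : 1 ≤ t) (ha : a % 2 = 0) (hv : a ≤ v)
    (hv' : v < a + 4 * t) :
    winding t a v - winding t a (cyclePred (4 * t) a v) = 1 ∨
      winding t a v - winding t a (cyclePred (4 * t) a v) = 1 - (4 * t : ℕ) := by
  have hp : a ≤ cyclePred (4 * t) a v ∧ cyclePred (4 * t) a v < a + 4 * t := by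
    unfold cyclePred
    split_ifs <;> omega
  unfold winding
  rw [if_neg (show ¬v < a by omega), if_neg (show ¬a + 4 * t ≤ v by omega),
    if_neg (show ¬cyclePred (4 * t) a v < a by omega),
    if_neg (show ¬a + 4 * t ≤ cyclePred (4 * t) a v by omega)]
  unfold cyclePred at hp ⊢
  split_ifs at hp ⊢ <;> omega

lemma winding_sub_cycleSucc {t a v : ℕ} (ht : 1 ≤ t) (ha : a % 2 = 0) (hv : a ≤ v)
    (hv' : v < a + 4 * t) :
    winding t a v - winding t a (cycleSucc (4 * t) a v) = -1 ∨
      winding t a v - winding t a (cycleSucc (4 * t) a v) = -1 + (4 * t : ℕ) := by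
  have hp : a ≤ cycleSucc (4 * t) a v ∧ cycleSucc (4 * t) a v < a + 4 * t := by
    unfold cycleSucc
    split_ifs <;> omega
  unfold winding
  rw [if_neg (show ¬v < a by omega), if_neg (show ¬a + 4 * t ≤ v by omega),
    if_neg (show ¬cycleSucc (4 * t) a v < a by omega),
    if_neg (show ¬a + 4 * t ≤ cycleSucc (4 * t) a v by omega)]
  unfold cycleSucc at hp ⊢
  split_ifs at hp ⊢ <;> omega

lemma winding_eq_of_not_mem {t j v w : ℕ} (ht : 1 ≤ t)
    (hv : ¬(4 * t * j ≤ v ∧ v < 4 * t * j + 4 * t))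
    (h : ChainStep (4 * t) v w ∨ ChainStep (4 * t) w v) :
    winding t (4 * t * j) v = winding t (4 * t * j) w := by
  have ha : (4 * t * j) % 2 = 0 := by
    rw [mul_assoc, Nat.mul_mod]
    simp
  by_cases hw : 4 * t * j ≤ w ∧ w < 4 * t * j + 4 * t
  · rw [or_comm, chainStep_cases ht hw.1 hw.2] at h
    unfold cyclePred cycleSucc at h
    unfold winding
    generalize 4 * t * j = a at *
    have h' : (w + 2 = a + 4 * t ∧ v = w + 2) ∨ (w = a ∧ w = v + 2) := by
      split_ifs at h <;> omega
    split_ifs <;> omega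
  · have hvw : v ≤ w + 2 ∧ w ≤ v + 2 := by
      unfold ChainStep at h
      omega
    unfold winding
    generalize 4 * t * j = a at *
    split_ifs <;> omega

lemma dvd_lap_winding {t n j : ℕ} (ht : 1 ≤ t) (hn : 4 * t * (j + 1) ≤ n) (v : Fin n) :
    ((4 * t : ℕ) : ℤ) ∣ lap (cycleChain (4 * t) n) (fun v => winding t (4 * t * j) v) v := by
  have ha : (4 * t * j) % 2 = 0 := by
    rw [mul_assoc, Nat.mul_mod]
    simp
  rw [mul_add, mul_one] at hn
  by_cases hv : 4 * t * j ≤ v ∧ (v : ℕ) < 4 * t * j + 4 * t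
  · have hpred := winding_sub_cyclePred ht ha hv.1 hv.2
    have hsucc := winding_sub_cycleSucc ht ha hv.1 hv.2
    have hlt : cyclePred (4 * t) (4 * t * j) v < n ∧ cycleSucc (4 * t) (4 * t * j) v < n ∧
        cyclePred (4 * t) (4 * t * j) v ≠ cycleSucc (4 * t) (4 * t * j) v := by
      unfold cyclePred cycleSucc
      generalize 4 * t * j = a at *
      refine ⟨?_, ?_, ?_⟩ <;> split_ifs <;> omega
    have hsum : (∑ w : Fin n, ((if (w : ℕ) = cyclePred (4 * t) (4 * t * j) v then (1 : ℤ) else 0) +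
        if (w : ℕ) = cycleSucc (4 * t) (4 * t * j) v then (-1 : ℤ) else 0)) = 0 := by
      rw [Finset.sum_add_distrib, sum_ite_val_eq hlt.1, sum_ite_val_eq hlt.2.1]
      norm_num
    rw [← sub_zero (lap _ _ _), ← hsum, lap, ← Finset.sum_sub_distrib]
    refine Finset.dvd_sum fun w _ => ?_
    have hadj : (cycleChain (4 * t) n).Adj v w ↔ _ := chainStep_cases ht hv.1 hv.2
    by_cases hp : (w : ℕ) = cyclePred (4 * t) (4 * t * j) v
    · rw [if_pos (hadj.2 (Or.inl hp)), if_pos hp, if_neg (by omega), hp]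
      rcases hpred with h | h <;> simp [h]
    · by_cases hs : (w : ℕ) = cycleSucc (4 * t) (4 * t * j) v
      · rw [if_pos (hadj.2 (Or.inr (Or.inl hs))), if_neg hp, if_pos hs, hs]
        rcases hsucc with h | h <;> simp [h]
      · rw [if_neg hp, if_neg hs, add_zero, sub_zero]
        by_cases h : (cycleChain (4 * t) n).Adj v w
        · have hw : ¬(4 * t * j ≤ (w : ℕ) ∧ (w : ℕ) < 4 * t * j + 4 * t) := by
            rcases hadj.1 h with h' | h' | h' | h' <;> omega
          rw [if_pos h, winding_eq_of_not_mem ht hw h.symm, sub_self]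
          exact dvd_zero _
        · rw [if_neg h]
          exact dvd_zero _
  · rw [lap, Finset.sum_eq_zero]
    · exact dvd_zero _
    · intro w _
      by_cases h : (cycleChain (4 * t) n).Adj v w
      · rw [if_pos h, winding_eq_of_not_mem ht hv h, sub_self]
      · rw [if_neg h]

/-- The number of chips of `D` on vertices smaller than `m`. -/
def chipsBelow {n : ℕ} (D : Fin n → ℤ) (m : ℕ) : ℤ :=
  ∑ v : Fin n, if (v : ℕ) < m then D v else 0

lemma chipsBelow_nonneg {n : ℕ} {D : Fin n → ℤ} (hD : Effective D) (m : ℕ) :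
    0 ≤ chipsBelow D m :=
  Finset.sum_nonneg fun v _ => by
    have := hD v
    split_ifs <;> omega

lemma chipsBelow_le_degDiv {n : ℕ} {D : Fin n → ℤ} (hD : Effective D) (m : ℕ) :
    chipsBelow D m ≤ degDiv D :=
  Finset.sum_le_sum fun v _ => by
    have := hD v
    split_ifs <;> omega

lemma chipsBelow_add_le {n : ℕ} {D : Fin n → ℤ} (hD : Effective D) {m m' : ℕ} {v : Fin n}
    (hm : m ≤ v) (hm' : v < m') : chipsBelow D m + D v ≤ chipsBelow D m' := by
  have h : D v = ∑ u, if u = v then D u else 0 := by simp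
  rw [h]
  simp only [chipsBelow, ← Finset.sum_add_distrib]
  refine Finset.sum_le_sum fun u _ => ?_
  have := hD u
  by_cases huv : u = v
  · subst huv
    split_ifs <;> omega
  · split_ifs <;> omega

lemma chipsBelow_congr {n : ℕ} {D : Fin n → ℤ} {m m' : ℕ} (hm : m ≤ m')
    (h : ∀ v : Fin n, m ≤ v → v < m' → D v = 0) : chipsBelow D m = chipsBelow D m' :=
  Finset.sum_congr rfl fun v _ => by
    have := h v
    split_ifs <;> omega

/-- No chips can be moved across a cycle that is empty before and after. -/
lemma chipsBelow_eq_of_empty {t n j : ℕ} (ht : 1 ≤ t) (hn : 4 * t * (j + 1) ≤ n)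
    {D D' : Fin n → ℤ} (h : LinEquiv (cycleChain (4 * t) n) D D') (hD : Effective D)
    (hD' : Effective D') (hdeg : degDiv D < t)
    (he : ∀ v : Fin n, 4 * t * j ≤ v → v < 4 * t * (j + 1) → D v = 0)
    (he' : ∀ v : Fin n, 4 * t * j ≤ v → v < 4 * t * (j + 1) → D' v = 0) :
    chipsBelow D (4 * t * j) = chipsBelow D' (4 * t * j) := by
  have hdvd := h.dvd_sum_mul_sub (dvd_lap_winding ht hn)
  have hd := h.degDiv_eq
  have hsum : ∑ v : Fin n, winding t (4 * t * j) v * (D v - D' v) =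
      (2 * t - 1) * (chipsBelow D' (4 * t * j) - chipsBelow D (4 * t * j)) := by
    have h1 : chipsBelow D' (4 * t * j) - chipsBelow D (4 * t * j) =
        (degDiv D - chipsBelow D (4 * t * j)) - (degDiv D' - chipsBelow D' (4 * t * j)) := by
      rw [hd]; ring
    rw [h1]
    simp only [degDiv, chipsBelow, ← Finset.sum_sub_distrib, Finset.mul_sum]
    refine Finset.sum_congr rfl fun v _ => ?_
    have h2 := he v
    have h3 := he' v
    rw [mul_add, mul_one] at h2 h3
    unfold winding
    by_cases hv : (v : ℕ) < 4 * t * j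
    · simp [hv]
    · by_cases hv' : 4 * t * j + 4 * t ≤ v
      · simp [hv, hv']
      · rw [h2 (by omega) (by omega), h3 (by omega) (by omega)]
        simp
  rw [hsum] at hdvd
  have hcop : IsCoprime ((4 * t : ℕ) : ℤ) (2 * t - 1) :=
    ⟨-(t - 1), 2 * t - 1, by push_cast; ring⟩
  have h0 := Int.eq_zero_of_abs_lt_dvd (hcop.dvd_of_dvd_mul_left hdvd) (by
    have := chipsBelow_nonneg hD (4 * t * j)
    have := chipsBelow_nonneg hD' (4 * t * j)
    have := chipsBelow_le_degDiv hD (4 * t * j)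
    have := chipsBelow_le_degDiv hD' (4 * t * j)
    rw [abs_lt]
    push_cast
    constructor <;> omega)
  omega

/-- A divisor with fewer than `t` chips misses one of `t` consecutive blocks of `m` vertices. -/
lemma exists_empty_block {m t : ℕ} (hm : 0 < m) {D : Fin (m * t) → ℤ} (hD : Effective D)
    (hdeg : degDiv D < t) :
    ∃ b < t, ∀ v : Fin (m * t), m * b ≤ v → v < m * (b + 1) → D v = 0 := by
  by_contra! hcon
  have hP : ∀ b ≤ t, (b : ℤ) ≤ chipsBelow D (m * b) := by
    intro b
    induction b with
    | zero => intro _; exact chipsBelow_nonneg hD _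
    | succ b ih =>
      intro hb
      obtain ⟨v, h1, h2, h3⟩ := hcon b (by omega)
      have h4 := chipsBelow_add_le hD h1 h2
      have h5 := ih (by omega)
      have h6 := hD v
      push_cast
      omega
  have h1 := hP t le_rfl
  have h2 := chipsBelow_le_degDiv hD (m * t)
  omega

theorem le_degDiv_cycleChain {t : ℕ} (ht : 1 ≤ t) {D : Fin (4 * t * (2 * t + 1) * t) → ℤ}
    (hD : Effective D) (hr : PosRank (cycleChain (4 * t) (4 * t * (2 * t + 1) * t)) D) :
    (t : ℤ) ≤ degDiv D := by
  by_contra! hdeg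
  obtain ⟨b, hb, hempty⟩ := exists_empty_block (by positivity) hD hdeg
  have hbound : 4 * t * ((2 * t + 1) * (b + 1)) ≤ 4 * t * (2 * t + 1) * t := by
    rw [mul_assoc (4 * t)]
    exact Nat.mul_le_mul_left _ (Nat.mul_le_mul_left _ hb)
  simp only [mul_assoc (4 * t) (2 * t + 1) b, mul_assoc (4 * t) (2 * t + 1) (b + 1)] at hempty
  have hs : (2 * t + 1) * (b + 1) = (2 * t + 1) * b + (2 * t + 1) := by ring
  rw [hs] at hempty hbound
  generalize (2 * t + 1) * b = s at *
  have hc : ∀ i j : ℕ, i ≤ j → 4 * t * i ≤ 4 * t * j := fun i j h => Nat.mul_le_mul_left _ h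
  have hc1 : ∀ i : ℕ, 4 * t * i < 4 * t * (i + 1) := fun i =>
    Nat.mul_lt_mul_of_pos_left (by omega) (by omega)
  have hlt : 4 * t * (s + t) < 4 * t * (2 * t + 1) * t :=
    ((hc1 _).trans_le (hc _ _ (by omega))).trans_le hbound
  obtain ⟨D', hD', heq, hv⟩ := hr ⟨4 * t * (s + t), hlt⟩
  have hdeg' := heq.degDiv_eq
  obtain ⟨L, hL⟩ : ∃ L, L = chipsBelow D (4 * t * s) := ⟨_, rfl⟩
  have hLi : ∀ i ≤ 2 * t + 1, chipsBelow D (4 * t * (s + i)) = L := by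
    intro i hi
    rw [hL]
    refine (chipsBelow_congr (hc _ _ (by omega)) fun v h1 h2 => hempty v h1 ?_).symm
    exact h2.trans_le (hc _ _ (by omega))
  have hmono : ∀ i, chipsBelow D' (4 * t * (s + i)) ≤ chipsBelow D' (4 * t * (s + (i + 1))) :=
    fun i => Finset.sum_le_sum fun v _ => by
      have := hD' v
      have := hc1 (s + i)
      rw [add_assoc s i 1] at this
      split_ifs <;> omega
  have hstep : ∀ i ≤ 2 * t,
      chipsBelow D' (4 * t * (s + i)) = chipsBelow D' (4 * t * (s + (i + 1))) →
        chipsBelow D' (4 * t * (s + i)) = L := by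
    intro i hi h
    rw [← hLi i (by omega)]
    refine (chipsBelow_eq_of_empty ht ((hc _ _ (by omega)).trans hbound) heq hD hD' hdeg
      (fun v h1 h2 => hempty v ((hc _ _ (by omega)).trans h1)
        (h2.trans_le (hc _ _ (by omega)))) fun v h1 h2 => ?_).symm
    have h3 := chipsBelow_add_le hD' h1 h2
    have h4 := hD' v
    rw [add_assoc] at h3
    omega
  by_cases hcase : chipsBelow D' (4 * t * (s + t)) < L
  · have hdown : ∀ i ≤ t, chipsBelow D' (4 * t * (s + (t - i))) ≤ L - 1 - i := by
      intro i
      induction i with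
      | zero => intro _; simp; omega
      | succ i ih =>
        intro hi
        have h1 := ih (by omega)
        have h2 := hmono (t - (i + 1))
        have h3 := hstep (t - (i + 1)) (by omega)
        rw [show t - (i + 1) + 1 = t - i by omega] at h2 h3
        push_cast
        omega
    have h1 := hdown t le_rfl
    have h2 := chipsBelow_nonneg hD' (4 * t * (s + (t - t)))
    have h3 := chipsBelow_le_degDiv hD (4 * t * s)
    omega
  · have hup : ∀ i ≤ t, L + 1 + i ≤ chipsBelow D' (4 * t * (s + (t + 1 + i))) := by
      intro i
      induction i with
      | zero =>
        intro _
        have h1 := chipsBelow_add_le hD' (v := ⟨4 * t * (s + t), hlt⟩) le_rfl (hc1 (s + t))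
        dsimp only at h1
        rw [add_assoc s t 1] at h1
        simp only [Nat.cast_zero, add_zero]
        omega
      | succ i ih =>
        intro hi
        have h1 := ih (by omega)
        have h2 := hmono (t + 1 + i)
        have h3 := hstep (t + 1 + i) (by omega)
        rw [add_assoc (t + 1) i 1] at h2 h3
        push_cast
        omega
    have h1 := hup t le_rfl
    have h2 := chipsBelow_le_degDiv hD' (4 * t * (s + (t + 1 + t)))
    have h3 := chipsBelow_nonneg hD (4 * t * s)
    omega

/-- For every positive integer `t` there exist connected graphs `G ⊆ H` with
`gon(H) = 2` and `gon(G) ≥ t`. -/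
theorem stmt_16 (t : ℕ) (ht : 1 ≤ t) :
    ∃ (n : ℕ) (H : SimpleGraph (Fin n)) (G : H.Subgraph),
      H.Connected ∧ G.coe.Connected ∧ gonality H = 2 ∧ t ≤ gonality G.coe := by
  have hpos : 0 < t * (2 * t + 1) * t := by positivity
  have hmul : 4 * t * (2 * t + 1) * t = 4 * (t * (2 * t + 1) * t) := by ring
  have hG := cycleChain_connected (c := 4 * t) (n := 4 * t * (2 * t + 1) * t) (by omega)
  have hle := cycleChain_le_ladder (4 * t) (4 * t * (2 * t + 1) * t)
  have e : cycleChain (4 * t) (4 * t * (2 * t + 1) * t) ≃g (toSubgraph _ hle).coe :=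
    (toSubgraph _ hle).spanningCoeEquivCoeOfSpanning (toSubgraph.isSpanning _ hle)
  exact ⟨4 * t * (2 * t + 1) * t, ladder _, toSubgraph _ hle, hG.mono hle,
    e.connected_iff.1 hG, gonality_ladder (by omega) ⟨2 * (t * (2 * t + 1) * t), by omega⟩,
    le_gonality_of_iso e fun D => le_degDiv_cycleChain ht⟩
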